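/- Let q be a prime power, F the finite field with q elements, and 𝒞 a linear [n,k] code over F. For ℓ ≥ 1, let ℂ^(ℓ) = 𝒞 × 𝒞 × ⋯ × 𝒞 (ℓ factors) be the ℓ-fold Cartesian product, a linear [ℓn, ℓk] code over F. Then for every ω ≥ 0: (i) for every ℓ ≥ 1, (1/ℓ)·log |ℂ^(ℓ)(ω)| ≤ log α_𝒞(ω); and (ii) lim_{ℓ→∞} (1/ℓ)·log |ℂ^(ℓ)(ω)| = log α_𝒞(ω). -/

import Mathlib

open Filter Set

noncomputable section

/-- The weight enumerator polynomial `W_𝒞(z) = Σ_{i=0}^n W_i·z^i` of a linear code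
`𝒞 ⊆ F^n`, where `W_i` is the number of codewords of Hamming weight `i`. -/
def weightEnum {K : Type} [Field K] [Fintype K] [DecidableEq K]
    (n : ℕ) (Cc : Submodule K (Fin n → K)) (z : ℝ) : ℝ :=
  ∑ i ∈ Finset.range (n + 1),
    (({c : Fin n → K | c ∈ Cc ∧ hammingNorm c = i}).ncard : ℝ) * z ^ i

/-- `α_𝒞(ω) = inf_{z∈(0,1]} z^{-nω}·W_𝒞(z)`. -/
def alphaC {K : Type} [Field K] [Fintype K] [DecidableEq K]
    (n : ℕ) (Cc : Submodule K (Fin n → K)) (ω : ℝ) : ℝ :=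
  ⨅ z : Set.Ioc (0:ℝ) 1, ((z : ℝ) ^ (-((n : ℝ) * ω))) * weightEnum n Cc z

/-- The number of words of length `ℓ` over the alphabet `S` whose total weight is at most `t`. -/
def wordCount {S : Type*} [Fintype S] (w : S → ℕ) (ℓ : ℕ) (t : ℝ) : ℕ :=
  (Finset.univ.filter fun x : Fin ℓ → S => ((∑ i, w (x i) : ℕ) : ℝ) ≤ t).card

section WordCount

variable {S : Type*} [Fintype S] {w : S → ℕ}

lemma wordCount_pos {o : S} (ho : w o = 0) (ℓ : ℕ) {t : ℝ} (ht : 0 ≤ t) :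
    0 < wordCount w ℓ t :=
  Finset.card_pos.2 ⟨fun _ => o, by simpa [ho] using ht⟩

lemma wordCount_le_card_pow (ℓ : ℕ) (t : ℝ) : wordCount w ℓ t ≤ Fintype.card S ^ ℓ := by
  refine (Finset.card_filter_le _ _).trans ?_
  simp

lemma wordCount_mul_le (ℓ m : ℕ) (t u : ℝ) :
    wordCount w ℓ t * wordCount w m u ≤ wordCount w (ℓ + m) (t + u) := by
  unfold wordCount
  rw [← Finset.card_product]
  refine Finset.card_le_card_of_injOn (fun p => Fin.append p.1 p.2) ?_ ?_
  · rintro ⟨x, y⟩ h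
    simp only [Finset.coe_product, Finset.coe_filter, Finset.mem_univ, true_and, Set.mem_prod,
      Set.mem_ofPred_eq] at h
    simp only [Finset.coe_filter, Finset.mem_univ, true_and, Set.mem_ofPred_eq, Fin.sum_univ_add,
      Fin.append_left, Fin.append_right, Nat.cast_add]
    exact add_le_add h.1 h.2
  · rintro ⟨x, y⟩ - ⟨x', y'⟩ - h
    have hl : ∀ i, x i = x' i := fun i => by
      simpa using congrFun h (Fin.castAdd m i)
    have hr : ∀ i, y i = y' i := fun i => by
      simpa using congrFun h (Fin.natAdd ℓ i)
    exact Prod.ext (funext hl) (funext hr)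

lemma log_wordCount_add_le {o : S} (ho : w o = 0) (ℓ m : ℕ) {t u : ℝ} (ht : 0 ≤ t) (hu : 0 ≤ u) :
    Real.log (wordCount w ℓ t) + Real.log (wordCount w m u) ≤
      Real.log (wordCount w (ℓ + m) (t + u)) := by
  have h₁ := wordCount_pos ho ℓ ht
  have h₂ := wordCount_pos ho m hu
  rw [← Real.log_mul (by positivity) (by positivity)]
  exact Real.log_le_log (by positivity) (by exact_mod_cast wordCount_mul_le ℓ m t u)

lemma log_wordCount_le_of_le {o : S} (ho : w o = 0) {ℓ m : ℕ} (hℓ : ℓ ≤ m) {t u : ℝ} (ht : 0 ≤ t)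
    (hu : t ≤ u) : Real.log (wordCount w ℓ t) ≤ Real.log (wordCount w m u) := by
  obtain ⟨d, rfl⟩ := Nat.exists_eq_add_of_le hℓ
  have h := log_wordCount_add_le ho ℓ d ht (sub_nonneg.2 hu)
  rw [add_sub_cancel] at h
  have := Real.log_natCast_nonneg (wordCount w d (u - t))
  linarith

/-- By Fekete's lemma the exponential growth rate of `ℓ ↦ wordCount w ℓ (ℓ * θ)` exists and bounds
every term. -/
lemma exists_growthRate {o : S} (ho : w o = 0) {θ : ℝ} (hθ : 0 ≤ θ) :
    ∃ L : ℝ, Tendsto (fun ℓ : ℕ => Real.log (wordCount w ℓ (ℓ * θ)) / ℓ) atTop (nhds L) ∧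
      ∀ ℓ : ℕ, 1 ≤ ℓ → Real.log (wordCount w ℓ (ℓ * θ)) ≤ ℓ * L := by
  have hsub : Subadditive fun ℓ : ℕ => -Real.log (wordCount w ℓ (ℓ * θ)) := fun ℓ m => by
    have h := log_wordCount_add_le ho ℓ m (mul_nonneg ℓ.cast_nonneg hθ)
      (mul_nonneg m.cast_nonneg hθ)
    rw [← add_mul, ← Nat.cast_add] at h
    linarith
  have hbdd : BddBelow (range fun ℓ : ℕ => -Real.log (wordCount w ℓ (ℓ * θ)) / ℓ) := by
    refine ⟨-Real.log (Fintype.card S), ?_⟩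
    rintro _ ⟨ℓ, rfl⟩
    have hlog := Real.log_natCast_nonneg (Fintype.card S)
    rcases ℓ.eq_zero_or_pos with rfl | hℓ
    · simpa using hlog
    have hle : Real.log (wordCount w ℓ (ℓ * θ)) ≤ ℓ * Real.log (Fintype.card S) := by
      rw [← Real.log_pow]
      refine Real.log_le_log ?_ (by exact_mod_cast wordCount_le_card_pow ℓ _)
      exact_mod_cast wordCount_pos ho ℓ (mul_nonneg ℓ.cast_nonneg hθ)
    beta_reduce
    rw [le_div_iff₀ (by exact_mod_cast hℓ)]
    linarith
  refine ⟨-hsub.lim, ?_, fun ℓ hℓ => ?_⟩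
  · simpa [neg_div] using (hsub.tendsto_lim hbdd).neg
  · have h := hsub.lim_le_div hbdd (Nat.one_le_iff_ne_zero.1 hℓ)
    rw [le_div_iff₀ (by exact_mod_cast hℓ)] at h
    linarith

lemma concaveOn_growthRate {o : S} (ho : w o = 0) {Λ : ℝ → ℝ}
    (hΛ : ∀ θ, 0 ≤ θ →
      Tendsto (fun ℓ : ℕ => Real.log (wordCount w ℓ (ℓ * θ)) / ℓ) atTop (nhds (Λ θ))) :
    ConcaveOn ℝ (Ici 0) Λ := by
  refine concaveOn_iff_forall_pos.2 ⟨convex_Ici 0, fun x hx y hy a b ha hb hab => ?_⟩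
  rw [mem_Ici] at hx hy
  simp only [smul_eq_mul]
  have key : ∀ c θ : ℝ, 0 < c → 0 ≤ θ → Tendsto (fun ℓ : ℕ =>
      Real.log (wordCount w ⌊c * ℓ⌋₊ (⌊c * ℓ⌋₊ * θ)) / ℓ) atTop (nhds (c * Λ θ)) := by
    intro c θ hc hθ
    have hfloor : Tendsto (fun ℓ : ℕ => ⌊c * (ℓ : ℝ)⌋₊) atTop atTop :=
      tendsto_nat_floor_atTop.comp (tendsto_natCast_atTop_atTop.const_mul_atTop hc)
    have hratio := (tendsto_nat_floor_mul_div_atTop hc.le).comp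
      (tendsto_natCast_atTop_atTop (R := ℝ))
    refine (hratio.mul ((hΛ θ hθ).comp hfloor)).congr' ?_
    filter_upwards [hfloor.eventually_ge_atTop 1, eventually_ge_atTop 1] with ℓ h₁ h₂
    have h₁' : (⌊c * (ℓ : ℝ)⌋₊ : ℝ) ≠ 0 := by positivity
    simp only [Function.comp_apply]
    field_simp
  refine le_of_tendsto_of_tendsto' ((key a x ha hx).add (key b y hb hy))
    (hΛ _ (by positivity)) fun ℓ => ?_
  rw [← add_div]
  gcongr
  have hfa : (⌊a * (ℓ : ℝ)⌋₊ : ℝ) ≤ a * ℓ := Nat.floor_le (by positivity)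
  have hfb : (⌊b * (ℓ : ℝ)⌋₊ : ℝ) ≤ b * ℓ := Nat.floor_le (by positivity)
  refine (log_wordCount_add_le ho _ _ (by positivity) (by positivity)).trans
    (log_wordCount_le_of_le ho ?_ (by positivity) ?_)
  · have : ((⌊a * (ℓ : ℝ)⌋₊ + ⌊b * (ℓ : ℝ)⌋₊ : ℕ) : ℝ) ≤ (ℓ : ℝ) := by
      push_cast
      calc _ ≤ a * ℓ + b * ℓ := add_le_add hfa hfb
        _ = ℓ := by rw [← add_mul, hab, one_mul]
    exact_mod_cast this
  · calc _ ≤ a * ℓ * x + b * ℓ * y := by gcongr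
      _ = ℓ * (a * x + b * y) := by ring

lemma sum_pow_weight_pow (z : ℝ) (ℓ : ℕ) :
    (∑ s, z ^ w s) ^ ℓ = ∑ x : Fin ℓ → S, z ^ ∑ i, w (x i) := by
  simp_rw [Fintype.sum_pow, Finset.prod_pow_eq_pow_sum]

lemma wordCount_le_pow {z : ℝ} (hz : z ∈ Ioc (0 : ℝ) 1) (ℓ : ℕ) (θ : ℝ) :
    (wordCount w ℓ (ℓ * θ) : ℝ) ≤ (z ^ (-θ) * ∑ s, z ^ w s) ^ ℓ := by
  rw [mul_pow, sum_pow_weight_pow, Finset.mul_sum, wordCount, Finset.card_eq_sum_ones,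
    Nat.cast_sum, Finset.sum_filter]
  refine Finset.sum_le_sum fun x _ => ?_
  have hz0 := hz.1
  split_ifs with h
  · rw [← Real.rpow_natCast, ← Real.rpow_natCast, ← Real.rpow_mul hz0.le, ← Real.rpow_add hz0,
      Nat.cast_one]
    exact Real.one_le_rpow_of_pos_of_le_one_of_nonpos hz0 hz.2 (by linarith)
  · positivity

lemma sum_pow_weight_pow_le {z : ℝ} (hz : 0 ≤ z) {n : ℕ} (hw : ∀ s, w s ≤ n) (ℓ : ℕ) :
    (∑ s, z ^ w s) ^ ℓ ≤ ∑ j ∈ Finset.range (n * ℓ + 1), (wordCount w ℓ j : ℝ) * z ^ j := by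
  have hmem : ∀ x : Fin ℓ → S, ∑ i, w (x i) ∈ Finset.range (n * ℓ + 1) := fun x => by
    have : ∑ i, w (x i) ≤ ∑ _i : Fin ℓ, n := Finset.sum_le_sum fun i _ => hw _
    simp only [Finset.sum_const, Finset.card_univ, Fintype.card_fin, smul_eq_mul] at this
    rw [Finset.mem_range]
    linarith [mul_comm n ℓ]
  rw [sum_pow_weight_pow, ← Finset.sum_fiberwise_of_maps_to fun x _ => hmem x]
  refine Finset.sum_le_sum fun j _ => ?_
  have hfib : ∑ x : Fin ℓ → S with ∑ i, w (x i) = j, z ^ ∑ i, w (x i) =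
      ((Finset.univ.filter fun x : Fin ℓ → S => ∑ i, w (x i) = j).card : ℝ) * z ^ j := by
    rw [← nsmul_eq_mul]
    refine Finset.sum_eq_card_nsmul fun x hx => ?_
    rw [(Finset.mem_filter.1 hx).2]
  rw [hfib]
  gcongr
  refine Finset.card_le_card fun x hx => ?_
  simp only [Finset.mem_filter, Finset.mem_univ, true_and] at hx ⊢
  exact_mod_cast hx.le

end WordCount

lemma ConcaveOn.exists_supporting_slope {f : ℝ → ℝ} (hf : ConcaveOn ℝ (Ici 0) f)
    (hmono : MonotoneOn f (Ici 0)) {θ : ℝ} (hθ : 0 < θ) :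
    ∃ s : ℝ, 0 ≤ s ∧ ∀ x, 0 ≤ x → f x ≤ f θ + s * (x - θ) := by
  have hadj : ∀ x y, 0 ≤ x → x < θ → θ < y → (f y - f θ) / (y - θ) ≤ (f θ - f x) / (θ - x) :=
    fun x y hx hxθ hy => hf.slope_anti_adjacent (mem_Ici.2 hx) (mem_Ici.2 (hθ.trans hy).le) hxθ hy
  set A : Set ℝ := (fun y => (f y - f θ) / (y - θ)) '' Ioi θ
  have hbdd : BddAbove A := by
    refine ⟨(f θ - f 0) / (θ - 0), ?_⟩
    rintro _ ⟨y, hy, rfl⟩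
    exact hadj 0 y le_rfl hθ hy
  have hle : ∀ y, θ < y → (f y - f θ) / (y - θ) ≤ sSup A := fun y hy =>
    le_csSup hbdd ⟨y, hy, rfl⟩
  refine ⟨sSup A, ?_, fun x hx => ?_⟩
  · refine le_trans (div_nonneg (sub_nonneg.2 ?_) (by linarith)) (hle (θ + 1) (by linarith))
    exact hmono (mem_Ici.2 hθ.le) (mem_Ici.2 (by linarith)) (by linarith)
  · rcases lt_trichotomy x θ with h | rfl | h
    · have hs : sSup A ≤ (f θ - f x) / (θ - x) := by
        refine csSup_le ⟨_, θ + 1, by simp, rfl⟩ ?_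
        rintro _ ⟨y, hy, rfl⟩
        exact hadj x y hx h hy
      rw [le_div_iff₀ (by linarith)] at hs
      linarith
    · simp
    · have hs := hle x h
      rw [div_le_iff₀ (by linarith)] at hs
      linarith

/-- A polynomial factor does not affect the comparison of exponential growth rates. -/
lemma le_of_pow_le_linear_mul_pow {a b : ℝ} (hb : 0 < b) (n : ℕ)
    (h : ∀ ℓ : ℕ, 1 ≤ ℓ → a ^ ℓ ≤ ((n * ℓ + 1 : ℕ) : ℝ) * b ^ ℓ) : a ≤ b := by
  by_contra! hab
  have hr : 1 < a / b := (one_lt_div hb).2 hab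
  have hlim : Tendsto (fun ℓ : ℕ => ((n * ℓ + 1 : ℕ) : ℝ) / (a / b) ^ ℓ) atTop (nhds 0) := by
    have h₁ := (tendsto_pow_const_div_const_pow_of_one_lt 1 hr).const_mul (n : ℝ)
    have h₀ := tendsto_pow_const_div_const_pow_of_one_lt 0 hr
    simpa [add_div, mul_div_assoc] using h₁.add h₀
  obtain ⟨ℓ, hlt, hℓ⟩ := ((hlim.eventually_lt_const one_pos).and (eventually_ge_atTop 1)).exists
  rw [div_lt_one (by positivity), div_pow, lt_div_iff₀ (by positivity)] at hlt
  exact (h ℓ hℓ).not_gt hlt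

section Cramer

variable {S : Type*} [Fintype S] {w : S → ℕ}

lemma one_le_rpow_mul_sum_pow {o : S} (ho : w o = 0) {θ : ℝ} (hθ : 0 ≤ θ)
    (z : Ioc (0 : ℝ) 1) : 1 ≤ (z : ℝ) ^ (-θ) * ∑ s, (z : ℝ) ^ w s := by
  have hz0 := z.2.1
  refine one_le_mul_of_one_le_of_one_le
    (Real.one_le_rpow_of_pos_of_le_one_of_nonpos hz0 z.2.2 (by linarith)) ?_
  calc (1 : ℝ) = (z : ℝ) ^ w o := by simp [ho]
    _ ≤ _ := Finset.single_le_sum (f := fun s => (z : ℝ) ^ w s)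
      (fun s _ => by positivity) (Finset.mem_univ o)

lemma log_wordCount_le {o : S} (ho : w o = 0) {θ : ℝ} (hθ : 0 ≤ θ) {ℓ : ℕ} (hℓ : 1 ≤ ℓ) :
    Real.log (wordCount w ℓ (ℓ * θ)) / ℓ ≤
      Real.log (⨅ z : Ioc (0 : ℝ) 1, (z : ℝ) ^ (-θ) * ∑ s, (z : ℝ) ^ w s) := by
  have hne : Nonempty (Ioc (0 : ℝ) 1) := ⟨⟨1, by simp⟩⟩
  rw [← Real.log_exp (Real.log (wordCount w ℓ (ℓ * θ)) / ℓ)]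
  refine Real.log_le_log (Real.exp_pos _) (le_ciInf fun z => ?_)
  have hpos : (0 : ℝ) < (z : ℝ) ^ (-θ) * ∑ s, (z : ℝ) ^ w s :=
    one_pos.trans_le (one_le_rpow_mul_sum_pow ho hθ z)
  rw [← Real.le_log_iff_exp_le hpos, div_le_iff₀ (by exact_mod_cast hℓ),
    mul_comm (Real.log _), ← Real.log_pow]
  refine Real.log_le_log ?_ (wordCount_le_pow z.2 ℓ θ)
  exact_mod_cast wordCount_pos ho ℓ (mul_nonneg ℓ.cast_nonneg hθ)

lemma bddBelow_rpow_mul_sum_pow {o : S} (ho : w o = 0) {θ : ℝ} (hθ : 0 ≤ θ) :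
    BddBelow (range fun z : Ioc (0 : ℝ) 1 => (z : ℝ) ^ (-θ) * ∑ s, (z : ℝ) ^ w s) :=
  ⟨1, by rintro _ ⟨z, rfl⟩; exact one_le_rpow_mul_sum_pow ho hθ z⟩

lemma iInf_sum_pow_le_one {o : S} (ho : ∀ s, w s = 0 ↔ s = o) :
    ⨅ z : Ioc (0 : ℝ) 1, (z : ℝ) ^ (-(0 : ℝ)) * ∑ s, (z : ℝ) ^ w s ≤ 1 := by
  have hcont : Continuous fun z : ℝ => ∑ s, z ^ w s := by fun_prop
  have hzero : ∑ s, (0 : ℝ) ^ w s = 1 := by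
    rw [Finset.sum_eq_single o]
    · simp [(ho o).2 rfl]
    · exact fun s _ hs => zero_pow fun h => hs ((ho s).1 h)
    · simp
  have hlim : Tendsto (fun z : ℝ => ∑ s, z ^ w s) (nhdsWithin 0 (Ioi 0)) (nhds 1) := by
    have := hcont.tendsto 0
    rw [hzero] at this
    exact this.mono_left nhdsWithin_le_nhds
  refine ge_of_tendsto hlim ?_
  filter_upwards [Ioc_mem_nhdsGT (zero_lt_one' ℝ)] with z hz
  simpa using ciInf_le (bddBelow_rpow_mul_sum_pow ((ho o).2 rfl) le_rfl) ⟨z, hz⟩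

lemma tendsto_log_wordCount {o : S} (ho : ∀ s, w s = 0 ↔ s = o) {θ : ℝ} (hθ : 0 ≤ θ) :
    Tendsto (fun ℓ : ℕ => Real.log (wordCount w ℓ (ℓ * θ)) / ℓ) atTop
      (nhds (Real.log (⨅ z : Ioc (0 : ℝ) 1, (z : ℝ) ^ (-θ) * ∑ s, (z : ℝ) ^ w s))) := by
  have hwo : w o = 0 := (ho o).2 rfl
  have hne : Nonempty (Ioc (0 : ℝ) 1) := ⟨⟨1, by simp⟩⟩
  choose! Λ hlim hbound using fun θ (hθ : 0 ≤ θ) => exists_growthRate hwo hθ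
  suffices hle : Real.log (⨅ z : Ioc (0 : ℝ) 1, (z : ℝ) ^ (-θ) * ∑ s, (z : ℝ) ^ w s) ≤ Λ θ by
    have hge : Λ θ ≤ Real.log (⨅ z : Ioc (0 : ℝ) 1, (z : ℝ) ^ (-θ) * ∑ s, (z : ℝ) ^ w s) :=
      le_of_tendsto (hlim θ hθ) <| by
        filter_upwards [eventually_ge_atTop 1] with ℓ hℓ using log_wordCount_le hwo hθ hℓ
    rw [hle.antisymm hge]
    exact hlim θ hθ
  have hinf : 0 < ⨅ z : Ioc (0 : ℝ) 1, (z : ℝ) ^ (-θ) * ∑ s, (z : ℝ) ^ w s :=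
    one_pos.trans_le (le_ciInf (one_le_rpow_mul_sum_pow hwo hθ))
  rcases hθ.eq_or_lt with rfl | hpos
  · have hΛ : 0 ≤ Λ 0 := ge_of_tendsto' (hlim 0 le_rfl) fun ℓ =>
      div_nonneg (Real.log_natCast_nonneg _) ℓ.cast_nonneg
    exact (Real.log_nonpos hinf.le (iInf_sum_pow_le_one ho)).trans hΛ
  have hmono : MonotoneOn Λ (Ici 0) := fun x hx y hy hxy =>
    le_of_tendsto_of_tendsto' (hlim x hx) (hlim y hy) fun ℓ => by
      exact div_le_div_of_nonneg_right (log_wordCount_le_of_le hwo le_rfl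
        (mul_nonneg ℓ.cast_nonneg hx) (mul_le_mul_of_nonneg_left hxy ℓ.cast_nonneg)) ℓ.cast_nonneg
  obtain ⟨s, hs, hline⟩ := (concaveOn_growthRate hwo hlim).exists_supporting_slope hmono hpos
  obtain ⟨n, hn⟩ : ∃ n, ∀ a, w a ≤ n :=
    ⟨Finset.univ.sup w, fun a => Finset.le_sup (Finset.mem_univ a)⟩
  have hW : ∑ a, Real.exp (-s) ^ w a ≤ Real.exp (Λ θ - s * θ) := by
    refine le_of_pow_le_linear_mul_pow (Real.exp_pos _) n fun ℓ hℓ => ?_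
    refine (sum_pow_weight_pow_le (Real.exp_pos _).le hn ℓ).trans ?_
    refine (Finset.sum_le_card_nsmul _ _ (Real.exp (Λ θ - s * θ) ^ ℓ) fun j _ => ?_).trans
      (by simp [nsmul_eq_mul])
    have hℓ0 : (0 : ℝ) < ℓ := by exact_mod_cast hℓ
    have hj : (0 : ℝ) ≤ j / ℓ := by positivity
    have hcount : (wordCount w ℓ j : ℝ) ≤ Real.exp (ℓ * Λ (j / ℓ)) := by
      have h := hbound _ hj ℓ hℓ
      rw [mul_div_cancel₀ _ hℓ0.ne'] at h
      refine (Real.log_le_iff_le_exp ?_).1 h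
      exact_mod_cast wordCount_pos hwo ℓ j.cast_nonneg
    calc (wordCount w ℓ j : ℝ) * Real.exp (-s) ^ j
        ≤ Real.exp (ℓ * Λ (j / ℓ)) * Real.exp (-s) ^ j := by gcongr
      _ = Real.exp (ℓ * (Λ (j / ℓ) - s * (j / ℓ))) := by
        rw [← Real.exp_nat_mul, ← Real.exp_add]
        congr 1
        field_simp
        ring
      _ ≤ Real.exp (ℓ * (Λ θ - s * θ)) := by
        refine Real.exp_le_exp.2 (mul_le_mul_of_nonneg_left ?_ hℓ0.le)
        linarith [hline _ hj]
      _ = _ := Real.exp_nat_mul _ _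
  rw [Real.log_le_iff_le_exp hinf]
  refine (ciInf_le (bddBelow_rpow_mul_sum_pow hwo hθ)
    ⟨Real.exp (-s), Real.exp_pos _, Real.exp_le_one_iff.2 (by linarith)⟩).trans ?_
  calc Real.exp (-s) ^ (-θ) * ∑ a, Real.exp (-s) ^ w a
      ≤ Real.exp (-s) ^ (-θ) * Real.exp (Λ θ - s * θ) := by gcongr
    _ = Real.exp (Λ θ) := by
      rw [← Real.exp_mul, ← Real.exp_add]
      congr 1
      ring

end Cramer

section ProductCode

variable {K : Type} [Field K] [DecidableEq K] {n : ℕ}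

lemma weightEnum_eq_sum_pow [Fintype K] (Cc : Submodule K (Fin n → K)) [Fintype Cc] (z : ℝ) :
    weightEnum n Cc z = ∑ c : Cc, z ^ hammingNorm (c : Fin n → K) := by
  have hmem : ∀ c : Cc, hammingNorm (c : Fin n → K) ∈ Finset.range (n + 1) := fun c => by
    have := hammingNorm_le_card_fintype (x := (c : Fin n → K))
    rw [Fintype.card_fin] at this
    exact Finset.mem_range.2 (by omega)
  rw [weightEnum, ← Finset.sum_fiberwise_of_maps_to fun c _ => hmem c]
  refine Finset.sum_congr rfl fun i _ => ?_
  have hset : {c : Fin n → K | c ∈ Cc ∧ hammingNorm c = i} =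
      Subtype.val '' ((Finset.univ.filter fun c : Cc => hammingNorm (c : Fin n → K) = i :
        Finset Cc) : Set Cc) := by
    ext c
    simp [and_comm]
  rw [hset, Set.ncard_image_of_injective _ Subtype.val_injective, Set.ncard_coe_finset,
    ← nsmul_eq_mul]
  refine (Finset.sum_eq_card_nsmul fun c hc => ?_).symm
  rw [(Finset.mem_filter.1 hc).2]

lemma hammingNorm_uncurry {M : Type*} [Zero M] [DecidableEq M] {ℓ n : ℕ}
    (x : Fin ℓ × Fin n → M) :
    hammingNorm x = ∑ j, hammingNorm fun t => x (j, t) := by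
  simp only [hammingNorm, Finset.card_filter, Fintype.sum_prod_type]

lemma ncard_productCode (Cc : Submodule K (Fin n → K)) [Fintype Cc] (ω : ℝ) (ℓ : ℕ) :
    {x : Fin ℓ × Fin n → K | (∀ j : Fin ℓ, (fun t => x (j, t)) ∈ Cc) ∧
        (hammingNorm x : ℝ) ≤ ω * ((ℓ * n : ℕ) : ℝ)}.ncard =
      wordCount (fun c : Cc => hammingNorm (c : Fin n → K)) ℓ (ℓ * (n * ω)) := by
  have ht : ω * ((ℓ * n : ℕ) : ℝ) = ℓ * (n * ω) := by push_cast; ring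
  rw [ht, wordCount, ← Set.ncard_coe_finset]
  symm
  refine Set.ncard_congr (fun x _ p => (x p.1 : Fin n → K) p.2) ?_ ?_ ?_
  · intro x hx
    simp only [Finset.coe_filter, Finset.mem_univ, true_and, Set.mem_ofPred_eq] at hx
    refine ⟨fun j => (x j).2, ?_⟩
    rw [hammingNorm_uncurry]
    exact hx
  · intro x y _ _ h
    ext j t
    exact congrFun h (j, t)
  · rintro x ⟨hx, hle⟩
    refine ⟨fun j => ⟨fun t => x (j, t), hx j⟩, ?_, rfl⟩
    rw [hammingNorm_uncurry] at hle
    simpa using hle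

lemma alphaC_eq_iInf [Fintype K] (Cc : Submodule K (Fin n → K)) [Fintype Cc] (ω : ℝ) :
    alphaC n Cc ω = ⨅ z : Ioc (0 : ℝ) 1,
      (z : ℝ) ^ (-((n : ℝ) * ω)) * ∑ c : Cc, (z : ℝ) ^ hammingNorm (c : Fin n → K) := by
  simp_rw [alphaC, weightEnum_eq_sum_pow]

end ProductCode

/-- Lemma (Cramér for product codes): for a linear `[n,k]` code `𝒞` over `F` and its
`ℓ`-fold Cartesian product `ℂ^(ℓ)`, for every `ω ≥ 0`:
(i) `(1/ℓ)·log |ℂ^(ℓ)(ω)| ≤ log α_𝒞(ω)` for every `ℓ ≥ 1`, and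
(ii) `lim_{ℓ→∞} (1/ℓ)·log |ℂ^(ℓ)(ω)| = log α_𝒞(ω)`. -/
theorem cramer_product
    (K : Type) [Field K] [Fintype K] [DecidableEq K]
    (q : ℕ) (hq : Fintype.card K = q)
    (n k : ℕ) (Cc : Submodule K (Fin n → K))
    (hk : Module.finrank K Cc = k)
    (ω : ℝ) (hω : 0 ≤ ω) :
    (∀ ℓ : ℕ, 1 ≤ ℓ →
      (1 / (ℓ : ℝ)) * Real.log
          (({x : Fin ℓ × Fin n → K | (∀ j : Fin ℓ, (fun t => x (j, t)) ∈ Cc) ∧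
              (hammingNorm x : ℝ) ≤ ω * ((ℓ * n : ℕ) : ℝ)}).ncard : ℝ)
        ≤ Real.log (alphaC n Cc ω)) ∧
    Tendsto (fun ℓ : ℕ =>
        (1 / (ℓ : ℝ)) * Real.log
          (({x : Fin ℓ × Fin n → K | (∀ j : Fin ℓ, (fun t => x (j, t)) ∈ Cc) ∧
              (hammingNorm x : ℝ) ≤ ω * ((ℓ * n : ℕ) : ℝ)}).ncard : ℝ))
      atTop (nhds (Real.log (alphaC n Cc ω))) := by
  have hθ : 0 ≤ (n : ℝ) * ω := mul_nonneg n.cast_nonneg hω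
  have hfin := Fintype.ofFinite Cc
  set w : Cc → ℕ := fun c => hammingNorm (c : Fin n → K) with hw
  have ho : ∀ c, w c = 0 ↔ c = 0 := fun c => by
    rw [hw, hammingNorm_eq_zero, ZeroMemClass.coe_eq_zero]
  have hα : alphaC n Cc ω =
      ⨅ z : Ioc (0 : ℝ) 1, (z : ℝ) ^ (-((n : ℝ) * ω)) * ∑ c, (z : ℝ) ^ w c := alphaC_eq_iInf Cc ω
  rw [hα]
  refine ⟨fun ℓ hℓ => ?_, (tendsto_log_wordCount (w := w) ho hθ).congr fun ℓ => ?_⟩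
  · rw [ncard_productCode, one_div_mul_eq_div]
    exact log_wordCount_le (w := w) ((ho 0).2 rfl) hθ hℓ
  · rw [ncard_productCode, one_div_mul_eq_div]
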